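/- arXiv:2509.18465 — 2 statements merged into one kernel-verified Lean document; each statement's English description precedes it below -/
import Mathlib

section
/- Fix q ∈ ℝ with 0 < q < 1/2 and let a(H) := (Q(q)^H)_{1,0}. Then the map H ↦ λ(H,0) = a(H)/(a(H) + Hq) is strictly decreasing over integers H ≥ 1, and its maximum value is λ(1,0) = 1/2, attained at H = 1. (Hence with zero transmission cost the optimal threshold is H* = 1.) -/
open Matrix

/-- The one-step transition matrix of a symmetric two-state Markov chain
with switching probability `q`. -/
def Qmat (q : ℝ) : Matrix (Fin 2) (Fin 2) ℝ := !![1 - q, q; q, 1 - q]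

/-- `a q Δ` is the `(1,0)` entry of the `Δ`-th power of `Qmat q`. -/
def a (q : ℝ) (Δ : ℕ) : ℝ := (Qmat q ^ Δ) 1 0

/-- Time-average reward of the threshold policy with threshold `H`
under effective transmission cost `D`. -/
noncomputable def lam (q : ℝ) (H : ℕ) (D : ℝ) : ℝ :=
  (a q H - (a q H + q) * D) / (a q H + H * q)

theorem Qmat_pow (q : ℝ) (n : ℕ) :
    Qmat q ^ n = !![(1 + (1 - 2 * q) ^ n) / 2, (1 - (1 - 2 * q) ^ n) / 2;
      (1 - (1 - 2 * q) ^ n) / 2, (1 + (1 - 2 * q) ^ n) / 2] := by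
  induction n with
  | zero => ext i j; fin_cases i <;> fin_cases j <;> simp
  | succ n ih =>
    rw [pow_succ, ih, Qmat]
    ext i j
    fin_cases i <;> fin_cases j <;> simp [Matrix.mul_apply, Fin.sum_univ_two] <;> ring

theorem a_eq (q : ℝ) (n : ℕ) : a q n = (1 - (1 - 2 * q) ^ n) / 2 := by
  simp [a, Qmat_pow]

theorem a_one (q : ℝ) : a q 1 = q := by
  rw [a_eq]; ring

theorem a_succ (q : ℝ) (n : ℕ) : a q (n + 1) = a q n + q * (1 - 2 * q) ^ n := by
  rw [a_eq, a_eq]; ring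

theorem mul_pow_lt_a {q : ℝ} (hq0 : 0 < q) (hq1 : q < 1 / 2) {n : ℕ} (hn : 1 ≤ n) :
    n * (q * (1 - 2 * q) ^ n) < a q n := by
  induction n, hn using Nat.le_induction with
  | base => rw [a_one]; norm_num; nlinarith
  | succ n _ ih =>
    have hpos : 0 < q * (1 - 2 * q) ^ n := mul_pos hq0 (pow_pos (by linarith) n)
    have hstep : q * (1 - 2 * q) ^ (n + 1) ≤ q * (1 - 2 * q) ^ n := by
      rw [pow_succ]; nlinarith
    have hmul : (n : ℝ) * (q * (1 - 2 * q) ^ (n + 1)) ≤ n * (q * (1 - 2 * q) ^ n) := by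
      gcongr
    rw [a_succ]
    push_cast
    linarith

theorem a_pos {q : ℝ} (hq0 : 0 < q) (hq1 : q < 1 / 2) {n : ℕ} (hn : 1 ≤ n) : 0 < a q n :=
  lt_of_le_of_lt (mul_nonneg n.cast_nonneg
    (mul_nonneg hq0.le (pow_nonneg (by linarith) n))) (mul_pow_lt_a hq0 hq1 hn)

theorem lam_zero (q : ℝ) (n : ℕ) : lam q n 0 = a q n / (a q n + n * q) := by
  simp [lam]

theorem lam_one_zero {q : ℝ} (hq0 : 0 < q) : lam q 1 0 = 1 / 2 := by
  rw [lam_zero, a_one]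
  field_simp
  norm_num

theorem lam_succ_lt {q : ℝ} (hq0 : 0 < q) (hq1 : q < 1 / 2) {n : ℕ} (hn : 1 ≤ n) :
    lam q (n + 1) 0 < lam q n 0 := by
  have ha := a_pos hq0 hq1 hn
  have ha' := a_pos hq0 hq1 (Nat.le_succ_of_le hn)
  have hlt : n * a q (n + 1) < (n + 1) * a q n := by
    rw [a_succ]
    linarith [mul_pow_lt_a hq0 hq1 hn]
  rw [lam_zero, lam_zero, div_lt_div_iff₀ (by positivity) (by positivity)]
  push_cast
  linarith [mul_lt_mul_of_pos_right hlt hq0]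

theorem lam_zero_lt {q : ℝ} (hq0 : 0 < q) (hq1 : q < 1 / 2) {m n : ℕ} (hm : 1 ≤ m)
    (hmn : m < n) : lam q n 0 < lam q m 0 := by
  induction n, hmn using Nat.le_induction with
  | base => exact lam_succ_lt hq0 hq1 hm
  | succ n hn ih => exact (lam_succ_lt hq0 hq1 (by omega)).trans ih

theorem stmt_7 (q : ℝ) (hq0 : 0 < q) (hq1 : q < 1/2) :
    (∀ H₁ H₂ : ℕ, 1 ≤ H₁ → H₁ < H₂ → lam q H₂ 0 < lam q H₁ 0) ∧
    (∀ H : ℕ, 1 ≤ H → lam q H 0 = a q H / (a q H + H * q)) ∧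
    lam q 1 0 = 1/2 ∧
    (∀ H : ℕ, 1 ≤ H → lam q H 0 ≤ 1/2) := by
  refine ⟨fun _ _ h₁ h₂ => lam_zero_lt hq0 hq1 h₁ h₂, fun H _ => lam_zero q H,
    lam_one_zero hq0, fun H hH => ?_⟩
  rw [← lam_one_zero hq0]
  rcases hH.eq_or_lt with rfl | h
  · exact le_rfl
  · exact (lam_zero_lt hq0 hq1 le_rfl h).le
end

section
/- Fix q ∈ ℝ with 0 < q < 1/2 and let a(H) := (Q(q)^H)_{1,0}. Then for every integer H ≥ 1, λ(H,1) = −q/(a(H) + Hq) < 0, and λ(H,1) → 0 as H → ∞. (Hence with effective transmission cost D = 1 every finite threshold yields strictly negative time-average reward, so never transmitting, H* = ∞, is optimal.) -/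
open Matrix Filter

theorem Qmat_pow_apply_nonneg {q : ℝ} (hq0 : 0 ≤ q) (hq1 : q ≤ 1) (n : ℕ) (i j : Fin 2) :
    0 ≤ (Qmat q ^ n) i j := by
  induction n generalizing i j with
  | zero => rw [pow_zero, Matrix.one_apply]; split_ifs <;> norm_num
  | succ n ih =>
    rw [pow_succ, Matrix.mul_apply]
    refine Finset.sum_nonneg fun k _ => mul_nonneg (ih i k) ?_
    fin_cases k <;> fin_cases j <;> simp [Qmat, hq0, hq1]

theorem a_nonneg {q : ℝ} (hq0 : 0 ≤ q) (hq1 : q ≤ 1) (n : ℕ) : 0 ≤ a q n :=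
  Qmat_pow_apply_nonneg hq0 hq1 n 1 0

theorem lam_one_eq (q : ℝ) (H : ℕ) : lam q H 1 = -q / (a q H + H * q) := by
  rw [lam, mul_one, sub_add_cancel_left]

theorem stmt_8 (q : ℝ) (hq0 : 0 < q) (hq1 : q < 1/2) :
    (∀ H : ℕ, 1 ≤ H → lam q H 1 = -q / (a q H + H * q) ∧ lam q H 1 < 0) ∧
    Tendsto (fun H : ℕ => lam q H 1) atTop (nhds 0) := by
  have ha : ∀ H : ℕ, 0 ≤ a q H := a_nonneg hq0.le (by linarith)
  simp only [lam_one_eq]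
  refine ⟨fun H hH => ⟨trivial, div_neg_of_neg_of_pos (neg_neg_of_pos hq0) ?_⟩, ?_⟩
  · have hH' : (0 : ℝ) < H := by exact_mod_cast hH
    exact add_pos_of_nonneg_of_pos (ha H) (mul_pos hH' hq0)
  · refine Tendsto.const_div_atTop ?_ _
    exact tendsto_atTop_mono (fun H => le_add_of_nonneg_left (ha H))
      (tendsto_natCast_atTop_atTop.atTop_mul_const hq0)
end
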